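/- For each p with 0 ≤ p ≤ 6, the coefficient of x_1^2 x_2^2 x_3^2 y_{12}^2 y_{13}^2 y_{23}^2 in ∏_{1≤i<j≤3}(x_i+y_{ij})(x_j+y_{ij}) · (x_1+x_2+x_3)^p · (y_{12}+y_{13}+y_{23})^{6-p}, divided by 6, equals the value N_3(p, 6-p) where (N_3(0,6),…,N_3(6,0)) = (15, 30, 48, 57, 48, 30, 15). -/

import Mathlib

open MvPolynomial

/-- Variables: `x₁,x₂,x₃ = X 0, X 1, X 2`; `y₁₂,y₁₃,y₂₃ = X 3, X 4, X 5`.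
The class `[M] = ∏_{1≤i<j≤3} (xᵢ+y_{ij})(x_j+y_{ij})`. -/
noncomputable def threeLinesClass : MvPolynomial (Fin 6) ℤ :=
  (X 0 + X 3) * (X 1 + X 3) * (X 0 + X 4) * (X 2 + X 4) * (X 1 + X 5) * (X 2 + X 5)

/-- The number of ways to choose one variable from each list in `L` so that the product of the
chosen variables is the monomial with exponents `m`. -/
def countSelections {n : ℕ} : List (List (Fin n)) → (Fin n → ℕ) → ℕ
  | [], m => if ∀ i, m i = 0 then 1 else 0
  | l :: L, m =>
    (l.map fun i => if m i = 0 then 0 else countSelections L (Function.update m i (m i - 1))).sum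

/-- A coefficient of a product of sums of variables counts selections of variables. -/
theorem coeff_prod_sum_X {R : Type*} [CommSemiring R] {n : ℕ} (L : List (List (Fin n)))
    (m : Fin n → ℕ) :
    coeff (Finsupp.equivFunOnFinite.symm m)
      (L.map fun l => (l.map fun i => (X i : MvPolynomial (Fin n) R)).sum).prod =
      countSelections L m := by
  induction L generalizing m with
  | nil =>
    have h : (0 = Finsupp.equivFunOnFinite.symm m) ↔ ∀ i, m i = 0 := by
      simp [Finsupp.ext_iff, eq_comm]
    simp [countSelections, coeff_one, h]
  | cons l L ih =>
    simp only [List.map_cons, List.prod_cons, countSelections]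
    generalize hP : (L.map fun l => (l.map fun i => (X i : MvPolynomial (Fin n) R)).sum).prod = P
      at ih ⊢
    clear hP
    induction l with
    | nil => simp
    | cons i l ihl =>
      have h : Finsupp.equivFunOnFinite.symm m - Finsupp.single i 1 =
          Finsupp.equivFunOnFinite.symm (Function.update m i (m i - 1)) := by
        ext j
        by_cases hj : j = i
        · subst hj
          simp
        · simp [hj]
      simp only [List.map_cons, List.sum_cons, add_mul, coeff_add, ihl, coeff_X_mul', h, ih,
        Finsupp.mem_support_iff, Finsupp.equivFunOnFinite_symm_apply_apply, Nat.cast_add,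
        Nat.cast_ite, Nat.cast_zero, ite_not]

/-- For `0 ≤ p ≤ 6`, the coefficient of `x₁²x₂²x₃²y₁₂²y₁₃²y₂₃²` in
`[M]·(x₁+x₂+x₃)^p·(y₁₂+y₁₃+y₂₃)^{6-p}`, divided by 6, is the characteristic number
`N₃(p, 6-p)`, with values `(15, 30, 48, 57, 48, 30, 15)` for `p = 0,…,6`. -/
theorem characteristic_numbers_three_lines (p : ℕ) (hp : p ≤ 6) :
    MvPolynomial.coeff (Finsupp.equivFunOnFinite.symm fun _ : Fin 6 => (2 : ℕ))
        (threeLinesClass * (X 0 + X 1 + X 2) ^ p * (X 3 + X 4 + X 5) ^ (6 - p)) / 6 =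
      ([15, 30, 48, 57, 48, 30, 15] : List ℤ).getD p 0 := by
  have h : threeLinesClass * (X 0 + X 1 + X 2) ^ p * (X 3 + X 4 + X 5) ^ (6 - p) =
      (([[0, 3], [1, 3], [0, 4], [2, 4], [1, 5], [2, 5]] ++ List.replicate p [0, 1, 2] ++
        List.replicate (6 - p) [3, 4, 5] : List (List (Fin 6))).map
          fun l => (l.map fun i => (X i : MvPolynomial (Fin 6) ℤ)).sum).prod := by
    simp [threeLinesClass, mul_assoc, add_assoc]
  rw [h, coeff_prod_sum_X]
  clear h
  interval_cases p <;> decide +kernel
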